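/- Let N ≥ 0 and let 𝒟_{N+1} be the (N+1)×(N+1) real tridiagonal matrix (rows and columns indexed 0,…,N) with zero diagonal, superdiagonal entries (𝒟_{N+1})_{i,i+1} = i+1 for 0 ≤ i ≤ N−1, subdiagonal entries (𝒟_{N+1})_{i,i−1} = N−i+1 for 1 ≤ i ≤ N, and all other entries zero. Then for every real x, det(x·I_{N+1} + 𝒟_{N+1}) = ∏_{j=0}^{N} (x + N − 2j). -/

import Mathlib

/-- The Sylvester matrix `𝒟_{N+1}` of size `n = N + 1`: zero diagonal,
superdiagonal entries `i + 1`, subdiagonal entries `N - i + 1 = n - i` (0-indexed). -/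
def sylvesterD (n : ℕ) : Matrix (Fin n) (Fin n) ℝ :=
  Matrix.of fun i j =>
    if (j : ℕ) = (i : ℕ) + 1 then ((i : ℕ) + 1 : ℝ)
    else if (i : ℕ) = (j : ℕ) + 1 then ((n : ℝ) - (i : ℕ))
    else 0

/-- The upper unitriangular Pascal matrix, whose column `k` lists the coefficients of
`(1 + t) ^ k`. -/
def pascalMatrix (n : ℕ) : Matrix (Fin n) (Fin n) ℝ :=
  Matrix.of fun i k => ((k : ℕ).choose i : ℝ)

/-- The lower bidiagonal matrix of the operator `x + (1 - t²) d/dt + N t` in the basis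
`(1 + t) ^ k`, `0 ≤ k ≤ N`. -/
def sylvesterBidiagonal (N : ℕ) (x : ℝ) : Matrix (Fin (N + 1)) (Fin (N + 1)) ℝ :=
  Matrix.of fun j k =>
    (if (j : ℕ) = k then x + 2 * (k : ℕ) - N else 0) +
      if (j : ℕ) = (k : ℕ) + 1 then (N : ℝ) - (k : ℕ) else 0

theorem det_pascalMatrix (n : ℕ) : (pascalMatrix n).det = 1 := by
  rw [Matrix.det_of_isUpperTriangular]
  · simp [pascalMatrix]
  · intro i j hij
    simpa [pascalMatrix] using Nat.choose_eq_zero_of_lt (show (j : ℕ) < i from hij)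

theorem det_sylvesterBidiagonal (N : ℕ) (x : ℝ) :
    (sylvesterBidiagonal N x).det =
      ∏ j ∈ Finset.range (N + 1), (x + (N : ℝ) - 2 * (j : ℝ)) := by
  rw [Matrix.det_of_isLowerTriangular]
  · simp only [sylvesterBidiagonal, Matrix.of_apply, if_true, Nat.left_eq_add, one_ne_zero,
      if_false, add_zero]
    rw [Fin.prod_univ_eq_prod_range (fun k : ℕ => x + 2 * (k : ℝ) - N) (N + 1),
      ← Finset.prod_range_reflect]
    refine Finset.prod_congr rfl fun j hj => ?_
    have hj' : j ≤ N := Nat.lt_succ_iff.mp (Finset.mem_range.mp hj)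
    rw [Nat.add_sub_cancel, Nat.cast_sub hj']
    ring
  · intro i j hij
    have h : (i : ℕ) < j := hij
    simp only [sylvesterBidiagonal, Matrix.of_apply]
    rw [if_neg (by omega), if_neg (by omega), add_zero]

theorem Fin.sum_ite_val_eq {M : Type*} [AddCommMonoid M] (n a : ℕ) (f : ℕ → M) :
    (∑ j : Fin n, if (j : ℕ) = a then f j else 0) = if a < n then f a else 0 := by
  rw [Fin.sum_univ_eq_sum_range (fun j => if j = a then f j else 0) n]
  simp [Finset.sum_ite_eq']

theorem smul_one_add_sylvesterD_mul_pascalMatrix (N : ℕ) (x : ℝ) :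
    (x • (1 : Matrix (Fin (N + 1)) (Fin (N + 1)) ℝ) + sylvesterD (N + 1)) *
      pascalMatrix (N + 1) = pascalMatrix (N + 1) * sylvesterBidiagonal N x := by
  ext ⟨i, hi⟩ ⟨k, hk⟩
  have hR : (pascalMatrix (N + 1) * sylvesterBidiagonal N x) ⟨i, hi⟩ ⟨k, hk⟩ =
      (x + 2 * k - N) * k.choose i + (N - k) * (k + 1).choose i := by
    simp only [Matrix.mul_apply, pascalMatrix, sylvesterBidiagonal, Matrix.of_apply, mul_add,
      mul_ite, mul_zero, Finset.sum_add_distrib]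
    rw [Fin.sum_ite_val_eq _ _ fun j => (j.choose i : ℝ) * (x + 2 * k - N),
      Fin.sum_ite_val_eq _ _ fun j => (j.choose i : ℝ) * (N - k), if_pos hk]
    split_ifs with h
    · ring
    · obtain rfl : k = N := by omega
      ring
  have hS : (sylvesterD (N + 1) * pascalMatrix (N + 1)) ⟨i, hi⟩ ⟨k, hk⟩ =
      (i + 1) * k.choose (i + 1) + ((N : ℝ) + 1 - i) * if i = 0 then 0 else k.choose (i - 1) := by
    have hsplit : ∀ j : Fin (N + 1), sylvesterD (N + 1) ⟨i, hi⟩ j * pascalMatrix (N + 1) j ⟨k, hk⟩ =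
        (if (j : ℕ) = i + 1 then ((i : ℝ) + 1) * k.choose j else 0) +
        if i = 0 then 0 else
          if (j : ℕ) = i - 1 then ((N : ℝ) + 1 - i) * k.choose j else 0 := by
      intro j
      simp only [sylvesterD, pascalMatrix, Matrix.of_apply]
      push_cast
      split_ifs <;> first | omega | ring
    rw [Matrix.mul_apply, Finset.sum_congr rfl fun j _ => hsplit j, Finset.sum_add_distrib,
      Fin.sum_ite_val_eq _ _ fun j => ((i : ℝ) + 1) * k.choose j]
    congr 1
    · split_ifs with h
      · rfl
      · rw [Nat.choose_eq_zero_of_lt (by omega)]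
        simp
    · by_cases h : i = 0
      · simp [h]
      · simp only [h, if_false]
        rw [Fin.sum_ite_val_eq _ _ fun j => ((N : ℝ) + 1 - i) * k.choose j, if_pos (by omega)]
  have hsucc : ∀ m : ℕ, ((m : ℝ) + 1) * k.choose (m + 1) = (k - m) * k.choose m := by
    intro m
    rcases le_or_gt m k with hm | hm
    · have := Nat.choose_succ_right_eq k m
      have h : (k.choose (m + 1) : ℝ) * (m + 1) = k.choose m * (k - m) := by
        rw [← Nat.cast_sub hm]
        exact_mod_cast this
      linarith
    · rw [Nat.choose_eq_zero_of_lt hm, Nat.choose_eq_zero_of_lt (by omega)]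
      simp
  rw [hR, add_mul, Matrix.add_apply, hS, hsucc]
  simp only [Matrix.smul_mul, one_mul, Matrix.smul_apply, pascalMatrix, Matrix.of_apply,
    smul_eq_mul]
  cases i with
  | zero => simp; ring
  | succ m =>
    have h := hsucc m
    rw [Nat.choose_succ_succ k m]
    simp only [Nat.succ_ne_zero, if_false, Nat.add_sub_cancel]
    push_cast
    linear_combination -h

theorem sylvester_det (N : ℕ) (x : ℝ) :
    (x • (1 : Matrix (Fin (N + 1)) (Fin (N + 1)) ℝ) + sylvesterD (N + 1)).det =
      ∏ j ∈ Finset.range (N + 1), (x + (N : ℝ) - 2 * (j : ℝ)) := by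
  have h := congrArg Matrix.det (smul_one_add_sylvesterD_mul_pascalMatrix N x)
  rwa [Matrix.det_mul, Matrix.det_mul, det_pascalMatrix, mul_one, one_mul,
    det_sylvesterBidiagonal] at h
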